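/- arXiv:2409.13943 — 3 statements merged into one kernel-verified Lean document; each statement's English description precedes it below -/
import Mathlib

section
/- Suppose (MINLP) has a feasible solution. Then (MINLP) has an optimal solution (x, y, r, z, θ) together with (r^{k,s,p}) such that for every k ∈ K, s ∈ F^k∪{0}, and p ∈ P: (i) if b_i^{k,s}(x) = 0 for all i ∈ I, then {(i,j) ∈ L : z_{ij}^{k,s,p} = 1} is empty; (ii) otherwise, the set {(i,j) ∈ L : z_{ij}^{k,s,p} = 1} forms an elementary directed path i_0 → i_1 → ⋯ → i_t (t ≥ 1) with b_{i_0}^{k,s}(x) = −1 and b_{i_t}^{k,s}(x) = 1, along which r_{i_0 i_1}^{k,s,p} = ⋯ = r_{i_{t−1} i_t}^{k,s,p} =: ρ^{k,s,p}, and Σ_{p∈P} ρ^{k,s,p} = 1. -/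
open Finset

/-- Data of the network slicing (NS) problem. -/
structure NSData where
  I : Type
  fintypeI : Fintype I
  deqI : DecidableEq I
  K : Type
  fintypeK : Fintype K
  /-- the set of directed links -/
  L : Finset (I × I)
  /-- the set of cloud nodes -/
  V : Finset I
  /-- computational capacity of cloud nodes -/
  mu : I → ℝ
  /-- reliability of cloud nodes -/
  gv : I → ℝ
  /-- communication delay of links -/
  dl : I × I → ℝ
  /-- reliability of links -/
  gl : I × I → ℝ
  /-- communication capacity of links -/
  Cl : I × I → ℝ
  /-- source node of each service -/
  src : K → I
  /-- destination node of each service -/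
  dst : K → I
  /-- SFC length of each service -/
  len : K → ℕ
  /-- data rates -/
  lam : K → ℕ → ℝ
  /-- NFV delays -/
  dv : I → K → ℕ → ℝ
  /-- E2E delay thresholds -/
  Th : K → ℝ
  /-- E2E reliability thresholds -/
  Ga : K → ℝ
  /-- number of paths -/
  P : ℕ
  /-- objective weight -/
  sigma : ℝ
  hmu : ∀ v ∈ V, 0 < mu v
  hgv : ∀ v ∈ V, gv v ∈ Set.Ioc (0:ℝ) 1
  hdl : ∀ e ∈ L, 0 ≤ dl e
  hgl : ∀ e ∈ L, gl e ∈ Set.Ioc (0:ℝ) 1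
  hCl : ∀ e ∈ L, 0 < Cl e
  hsrc : ∀ k, src k ∉ V
  hdst : ∀ k, dst k ∉ V
  hlen : ∀ k, 1 ≤ len k
  hlam : ∀ k : K, ∀ s ≤ len k, 0 < lam k s
  hdv : ∀ v ∈ V, ∀ k : K, ∀ s : ℕ, 1 ≤ s → s ≤ len k → 0 ≤ dv v k s
  hTh : ∀ k, 0 < Th k
  hGa : ∀ k, Ga k ∈ Set.Ioc (0:ℝ) 1
  hP : 1 ≤ P
  hsigma : 0 < sigma

attribute [instance] NSData.fintypeI NSData.deqI NSData.fintypeK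

namespace NSData

variable (D : NSData)

/-- index set `F^k = {1,…,ℓ_k}` -/
def Fk (k : D.K) : Finset ℕ := Finset.Icc 1 (D.len k)

/-- index set `F^k ∪ {0} = {0,1,…,ℓ_k}` -/
def Fk0 (k : D.K) : Finset ℕ := Finset.Icc 0 (D.len k)

/-- path index set `P = {1,…,P}` -/
def Pset : Finset ℕ := Finset.Icc 1 D.P

theorem Pset_nonempty : D.Pset.Nonempty := Finset.nonempty_Icc.mpr D.hP

/-- sum of `f` over links coming into node `i` -/
noncomputable def inS (i : D.I) (f : D.I × D.I → ℝ) : ℝ :=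
  ∑ e ∈ D.L.filter (fun e => e.2 = i), f e

/-- sum of `f` over links going out of node `i` -/
noncomputable def outS (i : D.I) (f : D.I × D.I → ℝ) : ℝ :=
  ∑ e ∈ D.L.filter (fun e => e.1 = i), f e

/-- the right hand side `b_i^{k,s}(x)` of the flow conservation constraints -/
noncomputable def bfun (x : D.I → D.K → ℕ → ℝ) (i : D.I) (k : D.K) (s : ℕ) : ℝ :=
  if s = 0 ∧ i = D.src k then -1
  else if s = 0 ∧ i ∈ D.V then x i k 1
  else if 1 ≤ s ∧ s + 1 ≤ D.len k ∧ i ∈ D.V then x i k (s + 1) - x i k s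
  else if s = D.len k ∧ i ∈ D.V then -(x i k s)
  else if s = D.len k ∧ i = D.dst k then 1
  else 0

section Constraints

variable (xs : D.I → D.K → ℕ → ℝ) (xk : D.I → D.K → ℝ) (y : D.I → ℝ)
  (z : D.I × D.I → D.K → ℕ → ℕ → ℝ) (zk : D.I × D.I → D.K → ℝ)
  (r : D.I × D.I → D.K → ℕ → ℕ → ℝ) (rp : D.K → ℕ → ℕ → ℝ)
  (th : D.K → ℕ → ℝ) (r2 : D.I × D.I → D.K → ℕ → ℝ)

def C1 : Prop := ∀ k : D.K, ∀ s ∈ D.Fk k, ∑ v ∈ D.V, xs v k s = 1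

def C2 : Prop := ∀ v ∈ D.V, ∀ k : D.K, ∀ s ∈ D.Fk k, xs v k s ≤ xk v k

def C3 : Prop := ∀ v ∈ D.V, ∀ k : D.K, xk v k ≤ y v

def C4 : Prop := ∀ v ∈ D.V, ∑ k : D.K, ∑ s ∈ D.Fk k, D.lam k s * xs v k s ≤ D.mu v * y v

def C5 : Prop := ∀ k : D.K, ∀ s ∈ D.Fk0 k, ∀ p ∈ D.Pset, ∀ i : D.I,
  D.inS i (fun e => z e k s p) - D.outS i (fun e => z e k s p) = D.bfun xs i k s

def C6 : Prop := ∀ k : D.K, ∀ s ∈ D.Fk0 k, ∑ p ∈ D.Pset, rp k s p = 1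

def C7 : Prop := ∀ e ∈ D.L, ∀ k : D.K, ∀ s ∈ D.Fk0 k, ∀ p ∈ D.Pset,
  r e k s p = rp k s p * z e k s p

def C8 : Prop := ∀ e ∈ D.L,
  ∑ k : D.K, ∑ s ∈ D.Fk0 k, ∑ p ∈ D.Pset, D.lam k s * r e k s p ≤ D.Cl e

def C9 : Prop := ∀ e ∈ D.L, ∀ k : D.K, ∀ s ∈ D.Fk0 k, ∀ p ∈ D.Pset, z e k s p ≤ zk e k

def C10 : Prop := ∀ k : D.K,
  ∑ v ∈ D.V, Real.log (D.gv v) * xk v k + ∑ e ∈ D.L, Real.log (D.gl e) * zk e k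
    ≥ Real.log (D.Ga k)

def C11 : Prop := ∀ k : D.K, ∀ s ∈ D.Fk0 k,
  IsGreatest ((fun p => ∑ e ∈ D.L, D.dl e * z e k s p) '' (D.Pset : Set ℕ)) (th k s)

def C12 : Prop := ∀ k : D.K,
  ∑ v ∈ D.V, ∑ s ∈ D.Fk k, D.dv v k s * xs v k s + ∑ s ∈ D.Fk0 k, th k s ≤ D.Th k

def C16 : Prop := ∀ k : D.K, ∀ s ∈ D.Fk0 k, ∀ p ∈ D.Pset,
  ∑ e ∈ D.L, D.dl e * z e k s p ≤ th k s

def C18 : Prop := ∀ e ∈ D.L, ∀ k : D.K, ∀ s ∈ D.Fk0 k, ∑ p ∈ D.Pset, r e k s p ≤ zk e k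

def C19 : Prop := ∀ k : D.K, ∀ s ∈ D.Fk0 k,
  ∑ e ∈ D.L, D.dl e * ∑ p ∈ D.Pset, r e k s p ≤ th k s

def C20 : Prop := ∀ i : D.I, ∀ k : D.K, ∀ s ∈ D.Fk0 k, ∀ p ∈ D.Pset,
  D.outS i (fun e => z e k s p) ≤ 1

def C21 : Prop := ∀ e ∈ D.L, ∀ k : D.K, ∀ s ∈ D.Fk0 k, ∀ p ∈ D.Pset, r e k s p ≤ z e k s p

def C22 : Prop := ∀ k : D.K, ∀ s ∈ D.Fk0 k, ∀ i : D.I,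
  ((s = 0 ∧ (i ∈ D.V ∨ i = D.src k)) ∨ (s = D.len k ∧ (i ∈ D.V ∨ i = D.dst k)) ∨
      (1 ≤ s ∧ s + 1 ≤ D.len k ∧ i ∈ D.V)) →
    D.inS i (fun e => ∑ p ∈ D.Pset, r e k s p) - D.outS i (fun e => ∑ p ∈ D.Pset, r e k s p)
      = D.bfun xs i k s

def C23 : Prop := ∀ k : D.K, ∀ s ∈ D.Fk0 k, ∀ p ∈ D.Pset, ∀ i : D.I,
  (i ∉ D.V → D.inS i (fun e => r e k s p) - D.outS i (fun e => r e k s p) = 0) ∧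
  (i ∈ D.V → s + 1 ≤ D.len k →
    D.inS i (fun e => r e k s p) - D.outS i (fun e => r e k s p) ≤ xs i k (s + 1)) ∧
  (i ∈ D.V → 1 ≤ s →
    -(xs i k s) ≤ D.inS i (fun e => r e k s p) - D.outS i (fun e => r e k s p))

def C5II : Prop := ∀ k : D.K, ∀ s ∈ D.Fk0 k, ∀ i : D.I,
  D.inS i (fun e => r2 e k s) - D.outS i (fun e => r2 e k s) = D.bfun xs i k s

def C8II : Prop := ∀ e ∈ D.L, ∑ k : D.K, ∑ s ∈ D.Fk0 k, D.lam k s * r2 e k s ≤ D.Cl e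

def C9II : Prop := ∀ e ∈ D.L, ∀ k : D.K, ∀ s ∈ D.Fk0 k, r2 e k s ≤ zk e k

def C16II : Prop := ∀ k : D.K, ∀ s ∈ D.Fk0 k, ∑ e ∈ D.L, D.dl e * r2 e k s ≤ th k s

/-- binary requirements on the variables x, y, z -/
def BinVars : Prop :=
  (∀ v ∈ D.V, ∀ k : D.K, ∀ s ∈ D.Fk k, xs v k s = 0 ∨ xs v k s = 1) ∧
  (∀ v ∈ D.V, ∀ k : D.K, xk v k = 0 ∨ xk v k = 1) ∧
  (∀ v ∈ D.V, y v = 0 ∨ y v = 1) ∧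
  (∀ e ∈ D.L, ∀ k : D.K, ∀ s ∈ D.Fk0 k, ∀ p ∈ D.Pset, z e k s p = 0 ∨ z e k s p = 1) ∧
  (∀ e ∈ D.L, ∀ k : D.K, zk e k = 0 ∨ zk e k = 1)

/-- relaxed `[0,1]` requirements on the variables x, y, z -/
def UnitVars : Prop :=
  (∀ v ∈ D.V, ∀ k : D.K, ∀ s ∈ D.Fk k, xs v k s ∈ Set.Icc (0:ℝ) 1) ∧
  (∀ v ∈ D.V, ∀ k : D.K, xk v k ∈ Set.Icc (0:ℝ) 1) ∧
  (∀ v ∈ D.V, y v ∈ Set.Icc (0:ℝ) 1) ∧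
  (∀ e ∈ D.L, ∀ k : D.K, ∀ s ∈ D.Fk0 k, ∀ p ∈ D.Pset, z e k s p ∈ Set.Icc (0:ℝ) 1) ∧
  (∀ e ∈ D.L, ∀ k : D.K, zk e k ∈ Set.Icc (0:ℝ) 1)

def NonnegR : Prop := ∀ e ∈ D.L, ∀ k : D.K, ∀ s ∈ D.Fk0 k, ∀ p ∈ D.Pset, 0 ≤ r e k s p

def NonnegRP : Prop := ∀ k : D.K, ∀ s ∈ D.Fk0 k, ∀ p ∈ D.Pset, 0 ≤ rp k s p

def NonnegTh : Prop := ∀ k : D.K, ∀ s ∈ D.Fk0 k, 0 ≤ th k s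

def UnitR2 : Prop := ∀ e ∈ D.L, ∀ k : D.K, ∀ s ∈ D.Fk0 k, r2 e k s ∈ Set.Icc (0:ℝ) 1

/-- common objective function of (MINLP), (MILP), (NLP) and (LP-I) -/
noncomputable def Obj : ℝ :=
  ∑ v ∈ D.V, y v +
    D.sigma * ∑ e ∈ D.L, ∑ k : D.K, ∑ s ∈ D.Fk0 k, ∑ p ∈ D.Pset, D.lam k s * r e k s p

/-- objective function of (LP-II) -/
noncomputable def ObjII : ℝ :=
  ∑ v ∈ D.V, y v + D.sigma * ∑ e ∈ D.L, ∑ k : D.K, ∑ s ∈ D.Fk0 k, D.lam k s * r2 e k s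

/-- feasibility for problem (MINLP) -/
def MINLPFeas : Prop :=
  D.C1 xs ∧ D.C2 xs xk ∧ D.C3 xk y ∧ D.C4 xs y ∧ D.C5 xs z ∧ D.C6 rp ∧
    D.C7 z r rp ∧ D.C8 r ∧ D.C9 z zk ∧ D.C10 xk zk ∧ D.C11 z th ∧ D.C12 xs th ∧
    D.BinVars xs xk y z zk ∧ D.NonnegR r ∧ D.NonnegRP rp ∧ D.NonnegTh th

/-- feasibility for problem (MINLP) with (C11) replaced by (C16) -/
def MINLP16Feas : Prop :=
  D.C1 xs ∧ D.C2 xs xk ∧ D.C3 xk y ∧ D.C4 xs y ∧ D.C5 xs z ∧ D.C6 rp ∧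
    D.C7 z r rp ∧ D.C8 r ∧ D.C9 z zk ∧ D.C10 xk zk ∧ D.C16 z th ∧ D.C12 xs th ∧
    D.BinVars xs xk y z zk ∧ D.NonnegR r ∧ D.NonnegRP rp ∧ D.NonnegTh th

/-- feasibility for problem (MILP) -/
def MILPFeas : Prop :=
  D.C1 xs ∧ D.C2 xs xk ∧ D.C3 xk y ∧ D.C4 xs y ∧ D.C8 r ∧ D.C9 z zk ∧ D.C10 xk zk ∧
    D.C12 xs th ∧ D.C16 z th ∧ D.C18 zk r ∧ D.C19 r th ∧ D.C20 z ∧ D.C21 z r ∧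
    D.C22 xs r ∧ D.C23 xs r ∧ D.BinVars xs xk y z zk ∧ D.NonnegR r ∧ D.NonnegTh th

/-- feasibility for problem (NLP), the continuous relaxation of (MINLP) -/
def NLPFeas : Prop :=
  D.C1 xs ∧ D.C2 xs xk ∧ D.C3 xk y ∧ D.C4 xs y ∧ D.C5 xs z ∧ D.C6 rp ∧
    D.C7 z r rp ∧ D.C8 r ∧ D.C9 z zk ∧ D.C10 xk zk ∧ D.C12 xs th ∧ D.C16 z th ∧
    D.UnitVars xs xk y z zk ∧ D.NonnegR r ∧ D.NonnegRP rp ∧ D.NonnegTh th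

/-- feasibility for problem (LP-I), the continuous relaxation of (MILP) -/
def LPIFeas : Prop :=
  D.C1 xs ∧ D.C2 xs xk ∧ D.C3 xk y ∧ D.C4 xs y ∧ D.C8 r ∧ D.C9 z zk ∧ D.C10 xk zk ∧
    D.C12 xs th ∧ D.C16 z th ∧ D.C18 zk r ∧ D.C19 r th ∧ D.C20 z ∧ D.C21 z r ∧
    D.C22 xs r ∧ D.C23 xs r ∧ D.UnitVars xs xk y z zk ∧ D.NonnegR r ∧ D.NonnegTh th

/-- feasibility for problem (LP-I'), which is (LP-I) with (C20) removed -/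
def LPIpFeas : Prop :=
  D.C1 xs ∧ D.C2 xs xk ∧ D.C3 xk y ∧ D.C4 xs y ∧ D.C8 r ∧ D.C9 z zk ∧ D.C10 xk zk ∧
    D.C12 xs th ∧ D.C16 z th ∧ D.C18 zk r ∧ D.C19 r th ∧ D.C21 z r ∧
    D.C22 xs r ∧ D.C23 xs r ∧ D.UnitVars xs xk y z zk ∧ D.NonnegR r ∧ D.NonnegTh th

/-- feasibility for problem (LP-II) -/
def LPIIFeas : Prop :=
  D.C1 xs ∧ D.C2 xs xk ∧ D.C3 xk y ∧ D.C4 xs y ∧ D.C10 xk zk ∧ D.C12 xs th ∧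
    D.C5II xs r2 ∧ D.C8II r2 ∧ D.C9II zk r2 ∧ D.C16II th r2 ∧
    (∀ v ∈ D.V, ∀ k : D.K, ∀ s ∈ D.Fk k, xs v k s ∈ Set.Icc (0:ℝ) 1) ∧
    (∀ v ∈ D.V, ∀ k : D.K, xk v k ∈ Set.Icc (0:ℝ) 1) ∧
    (∀ v ∈ D.V, y v ∈ Set.Icc (0:ℝ) 1) ∧
    (∀ e ∈ D.L, ∀ k : D.K, zk e k ∈ Set.Icc (0:ℝ) 1) ∧
    D.UnitR2 r2 ∧ D.NonnegTh th

/-- the links `{(i,j) ∈ L : z_{ij}^{k,s,p} = 1}` form an elementary directed path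
`i_0 → i_1 → ⋯ → i_t` (`t ≥ 1`) from the source (where `b = -1`) to the destination
(where `b = 1`) of flow `(k,s)`, along which the values of `r` all equal `ρ`. -/
def FormsPath (k : D.K) (s p : ℕ) (rho : ℝ) : Prop :=
  ∃ (t : ℕ) (f : ℕ → D.I), 1 ≤ t ∧
    (∀ m ≤ t, ∀ n ≤ t, f m = f n → m = n) ∧
    (∀ m < t, (f m, f (m + 1)) ∈ D.L) ∧
    {e : D.I × D.I | e ∈ D.L ∧ z e k s p = 1} = (fun m => (f m, f (m + 1))) '' Set.Iio t ∧
    D.bfun xs (f 0) k s = -1 ∧ D.bfun xs (f t) k s = 1 ∧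
    ∀ m < t, r (f m, f (m + 1)) k s p = rho

/-- optimality for problem (MINLP) -/
def MINLPOptimal : Prop :=
  D.MINLPFeas xs xk y z zk r rp th ∧
    ∀ (xs' : D.I → D.K → ℕ → ℝ) (xk' : D.I → D.K → ℝ) (y' : D.I → ℝ)
      (z' : D.I × D.I → D.K → ℕ → ℕ → ℝ) (zk' : D.I × D.I → D.K → ℝ)
      (r' : D.I × D.I → D.K → ℕ → ℕ → ℝ) (rp' : D.K → ℕ → ℕ → ℝ) (th' : D.K → ℕ → ℝ),
      D.MINLPFeas xs' xk' y' z' zk' r' rp' th' → D.Obj y r ≤ D.Obj y' r'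

/-- optimality for problem (MILP) -/
def MILPOptimal : Prop :=
  D.MILPFeas xs xk y z zk r th ∧
    ∀ (xs' : D.I → D.K → ℕ → ℝ) (xk' : D.I → D.K → ℝ) (y' : D.I → ℝ)
      (z' : D.I × D.I → D.K → ℕ → ℕ → ℝ) (zk' : D.I × D.I → D.K → ℝ)
      (r' : D.I × D.I → D.K → ℕ → ℕ → ℝ) (th' : D.K → ℕ → ℝ),
      D.MILPFeas xs' xk' y' z' zk' r' th' → D.Obj y r ≤ D.Obj y' r'

/-- optimality for problem (NLP) -/
def NLPOptimal : Prop :=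
  D.NLPFeas xs xk y z zk r rp th ∧
    ∀ (xs' : D.I → D.K → ℕ → ℝ) (xk' : D.I → D.K → ℝ) (y' : D.I → ℝ)
      (z' : D.I × D.I → D.K → ℕ → ℕ → ℝ) (zk' : D.I × D.I → D.K → ℝ)
      (r' : D.I × D.I → D.K → ℕ → ℕ → ℝ) (rp' : D.K → ℕ → ℕ → ℝ) (th' : D.K → ℕ → ℝ),
      D.NLPFeas xs' xk' y' z' zk' r' rp' th' → D.Obj y r ≤ D.Obj y' r'

/-- optimality for problem (LP-I') -/
def LPIpOptimal : Prop :=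
  D.LPIpFeas xs xk y z zk r th ∧
    ∀ (xs' : D.I → D.K → ℕ → ℝ) (xk' : D.I → D.K → ℝ) (y' : D.I → ℝ)
      (z' : D.I × D.I → D.K → ℕ → ℕ → ℝ) (zk' : D.I × D.I → D.K → ℝ)
      (r' : D.I × D.I → D.K → ℕ → ℕ → ℝ) (th' : D.K → ℕ → ℝ),
      D.LPIpFeas xs' xk' y' z' zk' r' th' → D.Obj y r ≤ D.Obj y' r'

end Constraints

/-- the set of objective values of feasible points of (MINLP) -/
def MINLPVals : Set ℝ :=
  {c | ∃ (xs : D.I → D.K → ℕ → ℝ) (xk : D.I → D.K → ℝ) (y : D.I → ℝ)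
    (z : D.I × D.I → D.K → ℕ → ℕ → ℝ) (zk : D.I × D.I → D.K → ℝ)
    (r : D.I × D.I → D.K → ℕ → ℕ → ℝ) (rp : D.K → ℕ → ℕ → ℝ) (th : D.K → ℕ → ℝ),
    D.MINLPFeas xs xk y z zk r rp th ∧ c = D.Obj y r}

/-- the set of objective values of feasible points of (MINLP) with (C11) replaced by (C16) -/
def MINLP16Vals : Set ℝ :=
  {c | ∃ (xs : D.I → D.K → ℕ → ℝ) (xk : D.I → D.K → ℝ) (y : D.I → ℝ)
    (z : D.I × D.I → D.K → ℕ → ℕ → ℝ) (zk : D.I × D.I → D.K → ℝ)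
    (r : D.I × D.I → D.K → ℕ → ℕ → ℝ) (rp : D.K → ℕ → ℕ → ℝ) (th : D.K → ℕ → ℝ),
    D.MINLP16Feas xs xk y z zk r rp th ∧ c = D.Obj y r}

/-- the set of objective values of feasible points of (NLP) -/
def NLPVals : Set ℝ :=
  {c | ∃ (xs : D.I → D.K → ℕ → ℝ) (xk : D.I → D.K → ℝ) (y : D.I → ℝ)
    (z : D.I × D.I → D.K → ℕ → ℕ → ℝ) (zk : D.I × D.I → D.K → ℝ)
    (r : D.I × D.I → D.K → ℕ → ℕ → ℝ) (rp : D.K → ℕ → ℕ → ℝ) (th : D.K → ℕ → ℝ),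
    D.NLPFeas xs xk y z zk r rp th ∧ c = D.Obj y r}

/-- the set of objective values of feasible points of (LP-I) -/
def LPIVals : Set ℝ :=
  {c | ∃ (xs : D.I → D.K → ℕ → ℝ) (xk : D.I → D.K → ℝ) (y : D.I → ℝ)
    (z : D.I × D.I → D.K → ℕ → ℕ → ℝ) (zk : D.I × D.I → D.K → ℝ)
    (r : D.I × D.I → D.K → ℕ → ℕ → ℝ) (th : D.K → ℕ → ℝ),
    D.LPIFeas xs xk y z zk r th ∧ c = D.Obj y r}

/-- the set of objective values of feasible points of (LP-I') -/
def LPIpVals : Set ℝ :=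
  {c | ∃ (xs : D.I → D.K → ℕ → ℝ) (xk : D.I → D.K → ℝ) (y : D.I → ℝ)
    (z : D.I × D.I → D.K → ℕ → ℕ → ℝ) (zk : D.I × D.I → D.K → ℝ)
    (r : D.I × D.I → D.K → ℕ → ℕ → ℝ) (th : D.K → ℕ → ℝ),
    D.LPIpFeas xs xk y z zk r th ∧ c = D.Obj y r}

/-- the set of objective values of feasible points of (LP-I) additionally satisfying `z = r` -/
def LPIValsEq : Set ℝ :=
  {c | ∃ (xs : D.I → D.K → ℕ → ℝ) (xk : D.I → D.K → ℝ) (y : D.I → ℝ)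
    (z : D.I × D.I → D.K → ℕ → ℕ → ℝ) (zk : D.I × D.I → D.K → ℝ)
    (r : D.I × D.I → D.K → ℕ → ℕ → ℝ) (th : D.K → ℕ → ℝ),
    D.LPIFeas xs xk y z zk r th ∧
      (∀ e ∈ D.L, ∀ k : D.K, ∀ s ∈ D.Fk0 k, ∀ p ∈ D.Pset, z e k s p = r e k s p) ∧
      c = D.Obj y r}

/-- the set of objective values of feasible points of (LP-I') additionally satisfying `z = r` -/
def LPIpValsEq : Set ℝ :=
  {c | ∃ (xs : D.I → D.K → ℕ → ℝ) (xk : D.I → D.K → ℝ) (y : D.I → ℝ)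
    (z : D.I × D.I → D.K → ℕ → ℕ → ℝ) (zk : D.I × D.I → D.K → ℝ)
    (r : D.I × D.I → D.K → ℕ → ℕ → ℝ) (th : D.K → ℕ → ℝ),
    D.LPIpFeas xs xk y z zk r th ∧
      (∀ e ∈ D.L, ∀ k : D.K, ∀ s ∈ D.Fk0 k, ∀ p ∈ D.Pset, z e k s p = r e k s p) ∧
      c = D.Obj y r}

/-- the set of objective values of feasible points of (LP-II) -/
def LPIIVals : Set ℝ :=
  {c | ∃ (xs : D.I → D.K → ℕ → ℝ) (xk : D.I → D.K → ℝ) (y : D.I → ℝ)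
    (zk : D.I × D.I → D.K → ℝ) (th : D.K → ℕ → ℝ) (r2 : D.I × D.I → D.K → ℕ → ℝ),
    D.LPIIFeas xs xk y zk th r2 ∧ c = D.ObjII y r2}

end NSData

/-- A node reachable along a relation is reachable along a sequence without repetitions. -/
theorem Relation.ReflTransGen.exists_injOn_seq {α : Type*} {R : α → α → Prop} {a c : α}
    (h : Relation.ReflTransGen R a c) :
    ∃ (t : ℕ) (f : ℕ → α), f 0 = a ∧ f t = c ∧ (∀ m < t, R (f m) (f (m + 1))) ∧
      ∀ m ≤ t, ∀ n ≤ t, f m = f n → m = n := by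
  classical
  have hex : ∃ (t : ℕ) (f : ℕ → α), f 0 = a ∧ f t = c ∧ ∀ m < t, R (f m) (f (m + 1)) := by
    induction h with
    | refl => exact ⟨0, fun _ => a, rfl, rfl, by simp⟩
    | @tail b d _ hbd ih =>
      obtain ⟨t, f, h0, ht, hR⟩ := ih
      refine ⟨t + 1, fun m => if m ≤ t then f m else d, by simpa using h0, by simp, ?_⟩
      intro m hm
      rcases Nat.lt_succ_iff_lt_or_eq.mp hm with hlt | rfl
      · simpa [hlt.le, Nat.succ_le_of_lt hlt] using hR m hlt
      · simpa [ht] using hbd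
  obtain ⟨f, h0, ht, hR⟩ := Nat.find_spec hex
  refine ⟨Nat.find hex, f, h0, ht, hR, ?_⟩
  have key : ∀ m n, m < n → n ≤ Nat.find hex → f m ≠ f n := by
    intro m n hmn hn heq
    refine Nat.find_min hex (m := Nat.find hex - (n - m)) (by omega)
      ⟨fun j => if j ≤ m then f j else f (j + (n - m)), by simpa using h0, ?_, ?_⟩
    · dsimp only
      split_ifs with hle
      · have h1 : n = Nat.find hex := by omega
        have h2 : Nat.find hex - (n - m) = m := by omega
        rw [h2, heq, ← ht, ← h1]
      · rw [Nat.sub_add_cancel (by omega), ht]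
    · intro j hj
      dsimp only
      rcases lt_trichotomy j m with hlt | rfl | hgt
      · rw [if_pos hlt.le, if_pos (by omega)]
        exact hR j (by omega)
      · rw [if_pos le_rfl, if_neg (by omega), heq]
        have h1 : j + 1 + (n - j) = n + 1 := by omega
        rw [h1]
        exact hR n (by omega)
      · rw [if_neg (by omega), if_neg (by omega)]
        have h1 : j + 1 + (n - m) = j + (n - m) + 1 := by omega
        rw [h1]
        exact hR _ (by omega)
  intro m hm n hn heq
  rcases lt_trichotomy m n with hlt | h | hgt
  · exact absurd heq (key m n hlt hn)
  · exact h
  · exact absurd heq.symm (key n m hgt hm)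

namespace NSData

variable {D : NSData}

/-- A nonnegative flow shipping one unit from `a` to `c` reaches `c` from `a` along links in its
support. -/
theorem reachable_of_flow {w : D.I × D.I → ℝ} {a c : D.I} (hw : ∀ e ∈ D.L, 0 ≤ w e)
    (hflow : ∀ i, D.inS i w - D.outS i w =
      (if c = i then (1 : ℝ) else 0) - (if a = i then (1 : ℝ) else 0)) :
    Relation.ReflTransGen (fun i j => (i, j) ∈ D.L ∧ w (i, j) ≠ 0) a c := by
  classical
  by_contra hc
  set R : Finset D.I := Finset.univ.filter
    (Relation.ReflTransGen (fun i j => (i, j) ∈ D.L ∧ w (i, j) ≠ 0) a) with hR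
  have hsum : ∑ i ∈ R, (D.inS i w - D.outS i w) = -1 := by
    simp only [hflow, Finset.sum_sub_distrib, Finset.sum_ite_eq]
    have h1 : a ∈ R := by simp [hR, Relation.ReflTransGen.refl]
    have h2 : c ∉ R := by simpa [hR] using hc
    simp [h1, h2]
  have hin : ∑ i ∈ R, D.inS i w = ∑ e ∈ D.L, if e.2 ∈ R then w e else 0 := by
    simp only [inS, Finset.sum_filter]
    rw [Finset.sum_comm]
    simp
  have hout : ∑ i ∈ R, D.outS i w = ∑ e ∈ D.L, if e.1 ∈ R then w e else 0 := by
    simp only [outS, Finset.sum_filter]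
    rw [Finset.sum_comm]
    simp
  have hle : ∑ i ∈ R, D.outS i w ≤ ∑ i ∈ R, D.inS i w := by
    rw [hin, hout]
    refine Finset.sum_le_sum fun e he => ?_
    by_cases hw0 : w e = 0
    · simp [hw0]
    · by_cases h1 : e.1 ∈ R
      · have h2 : e.2 ∈ R := by
          simp only [hR, Finset.mem_filter, Finset.mem_univ, true_and] at h1 ⊢
          exact h1.tail ⟨he, hw0⟩
        simp [h1, h2]
      · rw [if_neg h1]
        split_ifs
        · exact hw e he
        · exact le_rfl
  rw [Finset.sum_sub_distrib] at hsum
  linarith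

/-- The indicator function of the links of the node sequence `f 0, …, f t`. -/
noncomputable def pathInd (f : ℕ → D.I) (t : ℕ) (e : D.I × D.I) : ℝ :=
  if e ∈ (Finset.range t).image (fun m => (f m, f (m + 1))) then 1 else 0

theorem sum_filter_pathInd {f : ℕ → D.I} {t : ℕ}
    (hinj : ∀ m ≤ t, ∀ n ≤ t, f m = f n → m = n)
    (hL : ∀ m < t, (f m, f (m + 1)) ∈ D.L) (g : D.I × D.I → D.I) (i : D.I) :
    ∑ e ∈ D.L.filter (fun e => g e = i), pathInd f t e =
      ∑ m ∈ Finset.range t, if g (f m, f (m + 1)) = i then (1 : ℝ) else 0 := by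
  have hsub : (Finset.range t).image (fun m => (f m, f (m + 1))) ⊆ D.L := by
    intro e he
    obtain ⟨m, hm, rfl⟩ := Finset.mem_image.mp he
    exact hL m (Finset.mem_range.mp hm)
  have hinj' : Set.InjOn (fun m => (f m, f (m + 1))) (Finset.range t : Set ℕ) := by
    intro m hm n hn heq
    simp only [Finset.coe_range, Set.mem_Iio] at hm hn
    exact hinj m hm.le n hn.le (Prod.ext_iff.mp heq).1
  rw [← Finset.sum_image (f := fun e => if g e = i then (1 : ℝ) else 0) hinj',
    Finset.sum_filter]
  symm
  rw [← Finset.sum_subset_zero_on_sdiff hsub (f := fun e => if g e = i then (1 : ℝ) else 0)]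
  · intro e he
    simp only [Finset.mem_sdiff] at he
    simp [pathInd, he.2]
  · intro e he
    simp [pathInd, he]

/-- The indicator of an elementary path ships one unit from its first to its last node. -/
theorem flow_pathInd {f : ℕ → D.I} {t : ℕ} (hinj : ∀ m ≤ t, ∀ n ≤ t, f m = f n → m = n)
    (hL : ∀ m < t, (f m, f (m + 1)) ∈ D.L) (i : D.I) :
    D.inS i (pathInd f t) - D.outS i (pathInd f t) =
      (if f t = i then (1 : ℝ) else 0) - (if f 0 = i then (1 : ℝ) else 0) := by
  rw [inS, outS, sum_filter_pathInd hinj hL Prod.snd, sum_filter_pathInd hinj hL Prod.fst,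
    ← Finset.sum_sub_distrib]
  exact Finset.sum_range_sub (fun m => if f m = i then (1 : ℝ) else 0) t

/-- A binary family summing to one is the indicator of a single element. -/
theorem exists_eq_ite_of_sum_eq_one {ι : Type*} [DecidableEq ι] {A : Finset ι} {w : ι → ℝ}
    (hw : ∀ i ∈ A, w i = 0 ∨ w i = 1) (hsum : ∑ i ∈ A, w i = 1) :
    ∃ a ∈ A, ∀ i ∈ A, w i = if a = i then 1 else 0 := by
  have hex : ∃ a ∈ A, w a ≠ 0 := by
    by_contra! h
    simp [Finset.sum_eq_zero h] at hsum
  obtain ⟨a, ha, hwa⟩ := hex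
  have hwa1 : w a = 1 := (hw a ha).resolve_left hwa
  refine ⟨a, ha, fun i hi => ?_⟩
  split_ifs with h
  · rw [← h, hwa1]
  · rw [← Finset.add_sum_erase A w ha, hwa1, add_eq_left] at hsum
    refine (Finset.sum_eq_zero_iff_of_nonneg fun j hj => ?_).mp hsum i
      (Finset.mem_erase.mpr ⟨Ne.symm h, hi⟩)
    rcases hw j (Finset.mem_of_mem_erase hj) with h0 | h1
    · rw [h0]
    · rw [h1]; exact zero_le_one

/-- The flow `(k,s)` ships one unit between two (possibly equal) nodes. -/
theorem exists_bfun_eq {xs : D.I → D.K → ℕ → ℝ} (h1 : D.C1 xs)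
    (hbin : ∀ v ∈ D.V, ∀ k : D.K, ∀ s ∈ D.Fk k, xs v k s = 0 ∨ xs v k s = 1)
    (k : D.K) {s : ℕ} (hs : s ∈ D.Fk0 k) :
    ∃ a c : D.I, ∀ i, D.bfun xs i k s =
      (if c = i then (1 : ℝ) else 0) - (if a = i then (1 : ℝ) else 0) := by
  have hx : ∀ q ∈ D.Fk k, ∃ v ∈ D.V, ∀ i ∈ D.V, xs i k q = if v = i then 1 else 0 :=
    fun q hq => exists_eq_ite_of_sum_eq_one (fun v hv => hbin v hv k q hq) (h1 k q hq)
  have hlen := D.hlen k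
  have hsrc := D.hsrc k
  have hdst := D.hdst k
  simp only [Fk, Fk0, Finset.mem_Icc] at hx hs
  rcases Nat.eq_zero_or_pos s with rfl | hpos
  · obtain ⟨v, hv, hxv⟩ := hx 1 ⟨le_rfl, hlen⟩
    refine ⟨D.src k, v, fun i => ?_⟩
    have hne : ¬ (0 = D.len k) := by omega
    by_cases hi : i ∈ D.V
    · have hi1 : i ≠ D.src k := fun h => hsrc (h ▸ hi)
      simp [bfun, hi, hi1, hi1.symm, hxv i hi]
    · have hi2 : v ≠ i := fun h => hi (h ▸ hv)
      by_cases hi1 : i = D.src k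
      · subst hi1
        simp [bfun, hi2]
      · simp [bfun, hi, hi2, hi1, Ne.symm hi1, hne]
  · obtain ⟨u, hu, hxu⟩ := hx s ⟨hpos, hs.2⟩
    have hs0 : s ≠ 0 := by omega
    have hs1 : 1 ≤ s := hpos
    rcases Nat.lt_or_ge s (D.len k) with hlt | hge
    · obtain ⟨v, hv, hxv⟩ := hx (s + 1) ⟨by omega, hlt⟩
      refine ⟨u, v, fun i => ?_⟩
      have hne : s ≠ D.len k := by omega
      by_cases hi : i ∈ D.V
      · simp [bfun, hi, hs0, hs1, Nat.succ_le_of_lt hlt, hxu i hi, hxv i hi]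
      · have hi1 : u ≠ i := fun h => hi (h ▸ hu)
        have hi2 : v ≠ i := fun h => hi (h ▸ hv)
        simp [bfun, hi, hs0, hne, hi1, hi2]
    · have hse : s = D.len k := le_antisymm hs.2 hge
      have hns : ¬ (s + 1 ≤ D.len k) := by omega
      refine ⟨u, D.dst k, fun i => ?_⟩
      by_cases hi : i ∈ D.V
      · have hi1 : D.dst k ≠ i := fun h => hdst (h ▸ hi)
        simp only [bfun, hs0, hns, false_and, and_false, if_false, hi1]
        simp [hse.symm, hi, hxu i hi]
      · have hi2 : u ≠ i := fun h => hi (h ▸ hu)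
        simp only [bfun, hs0, hns, false_and, and_false, if_false, hi2]
        simp [hse.symm, hi, eq_comm]

theorem lam_nonneg {k : D.K} {s : ℕ} (hs : s ∈ D.Fk0 k) : 0 ≤ D.lam k s :=
  (D.hlam k s (Finset.mem_Icc.mp hs).2).le

/-- The load of a link is determined by the relevant values of `r`. -/
theorem load_congr {r r' : D.I × D.I → D.K → ℕ → ℕ → ℝ} {e : D.I × D.I}
    (h : ∀ k : D.K, ∀ s ∈ D.Fk0 k, ∀ p ∈ D.Pset, r e k s p = r' e k s p) :
    ∑ k : D.K, ∑ s ∈ D.Fk0 k, ∑ p ∈ D.Pset, D.lam k s * r e k s p =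
      ∑ k : D.K, ∑ s ∈ D.Fk0 k, ∑ p ∈ D.Pset, D.lam k s * r' e k s p :=
  Finset.sum_congr rfl fun k _ => Finset.sum_congr rfl fun s hs =>
    Finset.sum_congr rfl fun p hp => by rw [h k s hs p hp]

/-- The load of a link is monotone in `r`. -/
theorem load_mono {r r' : D.I × D.I → D.K → ℕ → ℕ → ℝ} {e : D.I × D.I}
    (h : ∀ k : D.K, ∀ s ∈ D.Fk0 k, ∀ p ∈ D.Pset, r e k s p ≤ r' e k s p) :
    ∑ k : D.K, ∑ s ∈ D.Fk0 k, ∑ p ∈ D.Pset, D.lam k s * r e k s p ≤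
      ∑ k : D.K, ∑ s ∈ D.Fk0 k, ∑ p ∈ D.Pset, D.lam k s * r' e k s p :=
  Finset.sum_le_sum fun k _ => Finset.sum_le_sum fun s hs =>
    Finset.sum_le_sum fun p hp => mul_le_mul_of_nonneg_left (h k s hs p hp) (lam_nonneg hs)

/-- For every feasible point there is one that is optimal among all feasible points with the
same binary values of `y` and `z`. -/
theorem exists_optimal_of_fixed_binary {xs : D.I → D.K → ℕ → ℝ} {xk : D.I → D.K → ℝ}
    {y : D.I → ℝ} {z : D.I × D.I → D.K → ℕ → ℕ → ℝ} {zk : D.I × D.I → D.K → ℝ}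
    {r : D.I × D.I → D.K → ℕ → ℕ → ℝ} {rp : D.K → ℕ → ℕ → ℝ} {th : D.K → ℕ → ℝ}
    (h : D.MINLPFeas xs xk y z zk r rp th) :
    ∃ r₀ rp₀, D.MINLPFeas xs xk y z zk r₀ rp₀ th ∧
      ∀ xs' xk' y' z' zk' r' rp' th', D.MINLPFeas xs' xk' y' z' zk' r' rp' th' →
        (∀ v ∈ D.V, y v = y' v) →
        (∀ e ∈ D.L, ∀ k : D.K, ∀ s ∈ D.Fk0 k, ∀ p ∈ D.Pset, z e k s p = z' e k s p) →
        D.Obj y r₀ ≤ D.Obj y' r' := by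
  let mulz : (D.K → ℕ → ℕ → ℝ) → D.I × D.I → D.K → ℕ → ℕ → ℝ :=
    fun ρ e k s p => ρ k s p * z e k s p
  let A : Set (D.K → ℕ → ℕ → ℝ) := Set.Icc 0 1 ∩ {ρ | D.C6 ρ ∧ D.C8 (mulz ρ)}
  have hclosed : IsClosed {ρ : D.K → ℕ → ℕ → ℝ | D.C6 ρ ∧ D.C8 (mulz ρ)} := by
    simp only [C6, C8, mulz, Set.ofPred_and, Set.ofPred_forall]
    refine IsClosed.inter ?_ ?_
    · refine isClosed_iInter fun k => isClosed_iInter fun s => isClosed_iInter fun _ => ?_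
      exact isClosed_eq (by fun_prop) continuous_const
    · refine isClosed_iInter fun e => isClosed_iInter fun _ => ?_
      exact isClosed_le (by fun_prop) continuous_const
  have hA : IsCompact A := isCompact_Icc.inter_right hclosed
  have hcont : Continuous fun ρ : D.K → ℕ → ℕ → ℝ => D.Obj y (mulz ρ) := by
    simp only [Obj, mulz]
    fun_prop
  have hclamp : ∀ xs' xk' y' z' zk' r' rp' th', D.MINLPFeas xs' xk' y' z' zk' r' rp' th' →
      (∀ v ∈ D.V, y v = y' v) →
      (∀ e ∈ D.L, ∀ k : D.K, ∀ s ∈ D.Fk0 k, ∀ p ∈ D.Pset, z e k s p = z' e k s p) →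
      ∃ ρ ∈ A, D.Obj y (mulz ρ) = D.Obj y' r' := by
    rintro xs' xk' y' z' zk' r' rp' th'
      ⟨-, -, -, -, -, h6, h7, h8, -, -, -, -, -, -, hrp, -⟩ hy hz
    have heq : ∀ k : D.K, ∀ s ∈ D.Fk0 k, ∀ p ∈ D.Pset, max 0 (min 1 (rp' k s p)) = rp' k s p := by
      intro k s hs p hp
      have hle : rp' k s p ≤ 1 :=
        h6 k s hs ▸ Finset.single_le_sum (fun q hq => hrp k s hs q hq) hp
      rw [min_eq_right hle, max_eq_right (hrp k s hs p hp)]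
    have hr : ∀ e ∈ D.L, ∀ k : D.K, ∀ s ∈ D.Fk0 k, ∀ p ∈ D.Pset,
        mulz (fun k s p => max 0 (min 1 (rp' k s p))) e k s p = r' e k s p := by
      intro e he k s hs p hp
      simp only [mulz]
      rw [heq k s hs p hp, h7 e he k s hs p hp, hz e he k s hs p hp]
    refine ⟨fun k s p => max 0 (min 1 (rp' k s p)), ⟨⟨?_, ?_⟩, ?_, ?_⟩, ?_⟩
    · intro k s p
      exact le_max_left _ _
    · intro k s p
      exact max_le zero_le_one (min_le_left _ _)
    · intro k s hs
      exact (Finset.sum_congr rfl fun p hp => heq k s hs p hp).trans (h6 k s hs)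
    · intro e he
      rw [load_congr (hr e he)]
      exact h8 e he
    · rw [Obj, Obj, Finset.sum_congr rfl hy, Finset.sum_congr rfl fun e he => load_congr (hr e he)]
  obtain ⟨ρ₁, hρ₁, -⟩ := hclamp xs xk y z zk r rp th h (fun _ _ => rfl)
    (fun _ _ _ _ _ _ _ => rfl)
  obtain ⟨ρ, ⟨⟨hρ0, -⟩, hρ6, hρ8⟩, hmin⟩ := hA.exists_isMinOn ⟨ρ₁, hρ₁⟩ hcont.continuousOn
  obtain ⟨h1, h2, h3, h4, h5, -, -, -, h9, h10, h11, h12, hb, -, -, hth⟩ := h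
  refine ⟨mulz ρ, ρ, ⟨h1, h2, h3, h4, h5, hρ6, fun _ _ _ _ _ _ _ => rfl, hρ8, h9, h10, h11, h12,
    hb, ?_, fun k s _ p _ => hρ0 k s p, hth⟩, ?_⟩
  · intro e he k s hs p hp
    refine mul_nonneg (hρ0 k s p) ?_
    rcases hb.2.2.2.1 e he k s hs p hp with h0 | h0 <;> simp [h0]
  · intro xs' xk' y' z' zk' r' rp' th' h' hy hz
    obtain ⟨ρ', hρ', hobj⟩ := hclamp xs' xk' y' z' zk' r' rp' th' h' hy hz
    rw [← hobj]
    exact hmin hρ'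

theorem exists_MINLPOptimal
    (hfeas : ∃ xs xk y z zk r rp th, D.MINLPFeas xs xk y z zk r rp th) :
    ∃ xs xk y z zk r rp th, D.MINLPOptimal xs xk y z zk r rp th := by
  let Pattern := (D.V → Prop) × (∀ (_ : D.L) (k : D.K), D.Fk0 k → D.Pset → Prop)
  let HasPattern : Pattern → (D.I → ℝ) → (D.I × D.I → D.K → ℕ → ℕ → ℝ) → Prop :=
    fun q y z => (∀ v, q.1 v ↔ y v = 1) ∧ ∀ e k s p, q.2 e k s p ↔ z e k s p = 1
  let Q : Set Pattern := {q | ∃ xs xk y z zk r rp th,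
    D.MINLPFeas xs xk y z zk r rp th ∧ HasPattern q y z}
  have hpat : ∀ xs xk y z zk r rp th, D.MINLPFeas xs xk y z zk r rp th →
      ∃ q ∈ Q, HasPattern q y z := fun xs xk y z zk r rp th h =>
    have hq : HasPattern (fun v => y v = 1, fun e k s p => z e k s p = 1) y z :=
      ⟨fun _ => Iff.rfl, fun _ _ _ _ => Iff.rfl⟩
    ⟨_, ⟨xs, xk, y, z, zk, r, rp, th, h, hq⟩, hq⟩
  have hagree : ∀ a b : ℝ, (a = 0 ∨ a = 1) → (b = 0 ∨ b = 1) → (a = 1 ↔ b = 1) → a = b := by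
    rintro a b (rfl | rfl) (rfl | rfl) <;> simp
  have hbest : ∀ q ∈ Q, ∃ c : ℝ,
      (∃ xs xk y z zk r rp th, D.MINLPFeas xs xk y z zk r rp th ∧ c = D.Obj y r) ∧
      ∀ xs xk y z zk r rp th, D.MINLPFeas xs xk y z zk r rp th → HasPattern q y z →
        c ≤ D.Obj y r := by
    rintro q ⟨xs, xk, y, z, zk, r, rp, th, h, hq⟩
    obtain ⟨r₀, rp₀, h₀, hmin⟩ := exists_optimal_of_fixed_binary h
    refine ⟨D.Obj y r₀, ⟨xs, xk, y, z, zk, r₀, rp₀, th, h₀, rfl⟩, ?_⟩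
    intro xs' xk' y' z' zk' r' rp' th' h' hmatch
    obtain ⟨-, -, -, -, -, -, -, -, -, -, -, -, ⟨-, -, hy, hz, -⟩, -⟩ := h
    have hfeas' := h'
    obtain ⟨-, -, -, -, -, -, -, -, -, -, -, -, ⟨-, -, hy', hz', -⟩, -⟩ := h'
    refine hmin xs' xk' y' z' zk' r' rp' th' hfeas' (fun v hv => ?_) (fun e he k s hs p hp => ?_)
    · exact hagree _ _ (hy v hv) (hy' v hv) ((hq.1 ⟨v, hv⟩).symm.trans (hmatch.1 ⟨v, hv⟩))
    · exact hagree _ _ (hz e he k s hs p hp) (hz' e he k s hs p hp)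
        ((hq.2 ⟨e, he⟩ k ⟨s, hs⟩ ⟨p, hp⟩).symm.trans (hmatch.2 ⟨e, he⟩ k ⟨s, hs⟩ ⟨p, hp⟩))
  choose! c hc hcmin using hbest
  obtain ⟨xs, xk, y, z, zk, r, rp, th, h⟩ := hfeas
  obtain ⟨q₁, hq₁, -⟩ := hpat xs xk y z zk r rp th h
  obtain ⟨q, hqQ, hqmin⟩ := Set.exists_min_image Q c (Set.toFinite Q) ⟨q₁, hq₁⟩
  obtain ⟨xs, xk, y, z, zk, r, rp, th, h, hobj⟩ := hc q hqQ
  refine ⟨xs, xk, y, z, zk, r, rp, th, h, ?_⟩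
  intro xs' xk' y' z' zk' r' rp' th' h'
  obtain ⟨q', hq'Q, hmatch⟩ := hpat xs' xk' y' z' zk' r' rp' th' h'
  rw [← hobj]
  exact (hqmin q' hq'Q).trans (hcmin q' hq'Q xs' xk' y' z' zk' r' rp' th' h' hmatch)

/-- Replacing the routing variables by smaller ones that satisfy flow conservation keeps
a solution of (MINLP) optimal. -/
theorem MINLPOptimal.of_le {xs : D.I → D.K → ℕ → ℝ} {xk : D.I → D.K → ℝ}
    {y : D.I → ℝ} {z z' : D.I × D.I → D.K → ℕ → ℕ → ℝ} {zk : D.I × D.I → D.K → ℝ}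
    {r : D.I × D.I → D.K → ℕ → ℕ → ℝ} {rp : D.K → ℕ → ℕ → ℝ} {th : D.K → ℕ → ℝ}
    (h : D.MINLPOptimal xs xk y z zk r rp th) (hflow : D.C5 xs z')
    (hbin : ∀ e ∈ D.L, ∀ k : D.K, ∀ s ∈ D.Fk0 k, ∀ p ∈ D.Pset, z' e k s p = 0 ∨ z' e k s p = 1)
    (hle : ∀ e ∈ D.L, ∀ k : D.K, ∀ s ∈ D.Fk0 k, ∀ p ∈ D.Pset, z' e k s p ≤ z e k s p) :
    D.MINLPOptimal xs xk y z' zk (fun e k s p => rp k s p * z' e k s p) rp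
      (fun k s => D.Pset.sup' D.Pset_nonempty fun p => ∑ e ∈ D.L, D.dl e * z' e k s p) := by
  obtain ⟨⟨h1, h2, h3, h4, -, h6, h7, h8, h9, h10, h11, h12, ⟨hb1, hb2, hb3, -, hb5⟩, -, hrp, -⟩,
    hopt⟩ := h
  have hz0 : ∀ e ∈ D.L, ∀ k : D.K, ∀ s ∈ D.Fk0 k, ∀ p ∈ D.Pset, 0 ≤ z' e k s p := by
    intro e he k s hs p hp
    rcases hbin e he k s hs p hp with h0 | h0 <;> simp [h0]
  have hr : ∀ e ∈ D.L, ∀ k : D.K, ∀ s ∈ D.Fk0 k, ∀ p ∈ D.Pset,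
      rp k s p * z' e k s p ≤ r e k s p := by
    intro e he k s hs p hp
    rw [h7 e he k s hs p hp]
    exact mul_le_mul_of_nonneg_left (hle e he k s hs p hp) (hrp k s hs p hp)
  have hload : ∀ e ∈ D.L,
      ∑ k : D.K, ∑ s ∈ D.Fk0 k, ∑ p ∈ D.Pset, D.lam k s * (rp k s p * z' e k s p) ≤
        ∑ k : D.K, ∑ s ∈ D.Fk0 k, ∑ p ∈ D.Pset, D.lam k s * r e k s p :=
    fun e he => load_mono (r := fun e k s p => rp k s p * z' e k s p) (hr e he)
  refine ⟨⟨h1, h2, h3, h4, hflow, h6, fun _ _ _ _ _ _ _ => rfl, ?_, ?_, h10, ?_, ?_,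
    ⟨hb1, hb2, hb3, hbin, hb5⟩, ?_, hrp, ?_⟩, ?_⟩
  · exact fun e he => (hload e he).trans (h8 e he)
  · exact fun e he k s hs p hp => (hle e he k s hs p hp).trans (h9 e he k s hs p hp)
  · intro k s _
    refine ⟨?_, ?_⟩
    · obtain ⟨p, hp, heq⟩ := Finset.exists_mem_eq_sup' D.Pset_nonempty
        fun p => ∑ e ∈ D.L, D.dl e * z' e k s p
      exact ⟨p, hp, heq.symm⟩
    · rintro _ ⟨p, hp, rfl⟩
      exact Finset.le_sup' (fun p => ∑ e ∈ D.L, D.dl e * z' e k s p) hp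
  · intro k
    refine le_trans ?_ (h12 k)
    gcongr with s hs
    refine Finset.sup'_le _ _ fun p hp => ?_
    refine le_trans ?_ ((h11 k s hs).2 ⟨p, hp, rfl⟩)
    exact Finset.sum_le_sum fun e he =>
      mul_le_mul_of_nonneg_left (hle e he k s hs p hp) (D.hdl e he)
  · exact fun e he k s hs p hp => mul_nonneg (hrp k s hs p hp) (hz0 e he k s hs p hp)
  · intro k s hs
    obtain ⟨p, hp⟩ := D.Pset_nonempty
    exact (Finset.sum_nonneg fun e he => mul_nonneg (D.hdl e he) (hz0 e he k s hs p hp)).trans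
      (Finset.le_sup' (fun p => ∑ e ∈ D.L, D.dl e * z' e k s p) hp)
  · intro xs' xk' y' z'' zk' r' rp' th' h'
    refine le_trans ?_ (hopt xs' xk' y' z'' zk' r' rp' th' h')
    rw [Obj, Obj]
    exact add_le_add_right (mul_le_mul_of_nonneg_left
      (Finset.sum_le_sum hload) D.hsigma.le) _

/-- The links used by the flow `(k,s)` on its `p`-th route contain an elementary path shipping
one unit as prescribed by flow conservation. -/
theorem exists_path_of_feas {xs : D.I → D.K → ℕ → ℝ} {xk : D.I → D.K → ℝ}
    {y : D.I → ℝ} {z : D.I × D.I → D.K → ℕ → ℕ → ℝ} {zk : D.I × D.I → D.K → ℝ}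
    {r : D.I × D.I → D.K → ℕ → ℕ → ℝ} {rp : D.K → ℕ → ℕ → ℝ} {th : D.K → ℕ → ℝ}
    (h : D.MINLPFeas xs xk y z zk r rp th) (k : D.K) (s : ℕ) (hs : s ∈ D.Fk0 k) (p : ℕ)
    (hp : p ∈ D.Pset) :
    ∃ (t : ℕ) (f : ℕ → D.I), (∀ m ≤ t, ∀ n ≤ t, f m = f n → m = n) ∧
      (∀ m < t, (f m, f (m + 1)) ∈ D.L ∧ z (f m, f (m + 1)) k s p = 1) ∧
      ∀ i, D.bfun xs i k s =
        (if f t = i then (1 : ℝ) else 0) - (if f 0 = i then (1 : ℝ) else 0) := by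
  obtain ⟨h1, -, -, -, h5, -, -, -, -, -, -, -, ⟨hbx, -, -, hbz, -⟩, -⟩ := h
  obtain ⟨a, c, hac⟩ := exists_bfun_eq h1 hbx k hs
  have hreach := reachable_of_flow (w := fun e => z e k s p) (a := a) (c := c)
    (fun e he => by rcases hbz e he k s hs p hp with h0 | h0 <;> simp [h0])
    (fun i => (h5 k s hs p hp i).trans (hac i))
  obtain ⟨t, f, rfl, rfl, hR, hinj⟩ := hreach.exists_injOn_seq
  exact ⟨t, f, hinj, fun m hm => ⟨(hR m hm).1,
    (hbz _ (hR m hm).1 k s hs p hp).resolve_left (hR m hm).2⟩, hac⟩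

end NSData

/-- If (MINLP) is feasible, then it has an optimal solution such that for every
`k`, `s` and `p`, either the source and destination of flow `(k,s)` coincide and no link is
used, or the used links form an elementary path from the source to the destination of flow
`(k,s)` carrying a common data rate `ρ^{k,s,p}`, with `Σ_{p∈P} ρ^{k,s,p} = 1`. -/
theorem statement4 (D : NSData)
    (hfeas : ∃ xs xk y z zk r rp th, D.MINLPFeas xs xk y z zk r rp th) :
    ∃ (xs : D.I → D.K → ℕ → ℝ) (xk : D.I → D.K → ℝ) (y : D.I → ℝ)
      (z : D.I × D.I → D.K → ℕ → ℕ → ℝ) (zk : D.I × D.I → D.K → ℝ)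
      (r : D.I × D.I → D.K → ℕ → ℕ → ℝ) (rp : D.K → ℕ → ℕ → ℝ) (th : D.K → ℕ → ℝ),
      D.MINLPOptimal xs xk y z zk r rp th ∧
        ∀ k : D.K, ∀ s ∈ D.Fk0 k,
          ((∀ i : D.I, D.bfun xs i k s = 0) →
            ∀ p ∈ D.Pset, {e : D.I × D.I | e ∈ D.L ∧ z e k s p = 1} = ∅) ∧
          (¬ (∀ i : D.I, D.bfun xs i k s = 0) →
            ∃ rho : ℕ → ℝ, (∀ p ∈ D.Pset, D.FormsPath xs z r k s p (rho p)) ∧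
              ∑ p ∈ D.Pset, rho p = 1) := by
  obtain ⟨xs, xk, y, z, zk, r, rp, th, hopt⟩ := NSData.exists_MINLPOptimal hfeas
  rcases isEmpty_or_nonempty D.K with hK | hK
  · exact ⟨xs, xk, y, z, zk, r, rp, th, hopt, fun k => hK.elim k⟩
  have : Nonempty D.I := hK.map D.src
  choose! t f hinj hedge hb using NSData.exists_path_of_feas hopt.1
  let z' : D.I × D.I → D.K → ℕ → ℕ → ℝ := fun e k s p => NSData.pathInd (f k s p) (t k s p) e
  have hset : ∀ k : D.K, ∀ s ∈ D.Fk0 k, ∀ p ∈ D.Pset,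
      {e : D.I × D.I | e ∈ D.L ∧ z' e k s p = 1} =
        (fun m => (f k s p m, f k s p (m + 1))) '' Set.Iio (t k s p) := by
    intro k s hs p hp
    ext e
    simp only [z', NSData.pathInd, Finset.mem_image, Finset.mem_range, Set.mem_ofPred_eq,
      ite_eq_left_iff, zero_ne_one, imp_false, not_not, Set.mem_image, Set.mem_Iio]
    refine ⟨And.right, fun he => ⟨?_, he⟩⟩
    obtain ⟨m, hm, rfl⟩ := he
    exact (hedge k s hs p hp m hm).1
  refine ⟨xs, xk, y, z', zk, _, rp, _, hopt.of_le (z' := z') ?_ ?_ ?_, fun k s hs => ⟨?_, ?_⟩⟩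
  · intro k s hs p hp i
    rw [hb k s hs p hp i]
    exact NSData.flow_pathInd (hinj k s hs p hp) (fun m hm => (hedge k s hs p hp m hm).1) i
  · intro e _ k s _ p _
    simp only [z', NSData.pathInd]
    split_ifs <;> simp
  · intro e he k s hs p hp
    simp only [z', NSData.pathInd]
    split_ifs with hmem
    · obtain ⟨m, hm, rfl⟩ := Finset.mem_image.mp hmem
      exact (hedge k s hs p hp m (Finset.mem_range.mp hm)).2.ge
    · rcases hopt.1.2.2.2.2.2.2.2.2.2.2.2.2.1.2.2.2.1 e he k s hs p hp with h0 | h0 <;> simp [h0]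
  · intro hzero p hp
    have ht : t k s p = 0 := by
      refine hinj k s hs p hp _ le_rfl _ (Nat.zero_le _) ?_
      by_contra hne
      have h0 := hb k s hs p hp (f k s p 0)
      rw [hzero, if_neg hne] at h0
      simp at h0
    rw [hset k s hs p hp, ht]
    simp
  · intro hnz
    refine ⟨rp k s, fun p hp => ?_, hopt.1.2.2.2.2.2.1 k s hs⟩
    have hne : f k s p (t k s p) ≠ f k s p 0 := by
      intro heq
      exact hnz fun i => by rw [hb k s hs p hp i, heq, sub_self]
    refine ⟨t k s p, f k s p, Nat.one_le_iff_ne_zero.mpr fun h0 => hne (by rw [h0]),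
      hinj k s hs p hp, fun m hm => (hedge k s hs p hp m hm).1, hset k s hs p hp, ?_, ?_, ?_⟩
    · simp [hb k s hs p hp, hne]
    · simp [hb k s hs p hp, hne.symm]
    · intro m hm
      have hz : z' (f k s p m, f k s p (m + 1)) k s p = 1 :=
        if_pos (Finset.mem_image_of_mem _ (Finset.mem_range.mpr hm))
      change rp k s p * z' _ k s p = _
      rw [hz, mul_one]
end

section
/- Let (x̄, ȳ, r̄, z̄, θ̄) together with (r̄^{k,s,p}) be a feasible solution of (NLP). Then Σ_{p∈P} r̄_{ij}^{k,s,p} ≤ 1 for all (i,j) ∈ L, k ∈ K, s ∈ F^k∪{0}; moreover, the point defined by x := x̄, y := ȳ, θ := θ̄, r_{ij}^{k,s,1} := Σ_{p∈P} r̄_{ij}^{k,s,p} and r_{ij}^{k,s,p} := 0 for p ≥ 2, r^{k,s,1} := 1 and r^{k,s,p} := 0 for p ≥ 2, z_{ij}^{k,s,p} := Σ_{p'∈P} r̄_{ij}^{k,s,p'} for every p ∈ P, and z_{ij}^k := z̄_{ij}^k, is also a feasible solution of (NLP) with the same objective value as (x̄, ȳ, r̄, z̄, θ̄). -/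
open Finset

/-- A weighted average of numbers that are at most `c` is at most `c`. -/
theorem weighted_sum_le {ι : Type*} {S : Finset ι} {w a : ι → ℝ} {c : ℝ}
    (hw : ∀ p ∈ S, 0 ≤ w p) (hsum : ∑ p ∈ S, w p = 1) (ha : ∀ p ∈ S, a p ≤ c) :
    ∑ p ∈ S, w p * a p ≤ c :=
  calc ∑ p ∈ S, w p * a p ≤ ∑ p ∈ S, w p * c :=
        Finset.sum_le_sum fun p hp => mul_le_mul_of_nonneg_left (ha p hp) (hw p hp)
    _ = c := by rw [← Finset.sum_mul, hsum, one_mul]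

namespace NSData

theorem one_mem_Pset (D : NSData) : 1 ∈ D.Pset := Finset.mem_Icc.mpr ⟨le_rfl, D.hP⟩

/-- Under (C7), a linear functional of the aggregated flow is the weighted average of the
functional over the paths. -/
theorem C7.sum_mul_sum {D : NSData} {z r : D.I × D.I → D.K → ℕ → ℕ → ℝ} {rp : D.K → ℕ → ℕ → ℝ}
    (h : D.C7 z r rp) {T : Finset (D.I × D.I)} (hT : T ⊆ D.L) (c : D.I × D.I → ℝ)
    (k : D.K) {s : ℕ} (hs : s ∈ D.Fk0 k) :
    ∑ e ∈ T, c e * ∑ p ∈ D.Pset, r e k s p =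
      ∑ p ∈ D.Pset, rp k s p * ∑ e ∈ T, c e * z e k s p := by
  simp only [Finset.mul_sum]
  rw [Finset.sum_comm]
  refine Finset.sum_congr rfl fun p hp => Finset.sum_congr rfl fun e he => ?_
  rw [h e (hT he) k s hs p hp]
  ring

/-- Concentrating the flow on the first path does not change the total weighted rate. -/
theorem sum_lam_mul_concentrate (D : NSData) (r : D.I × D.I → D.K → ℕ → ℕ → ℝ)
    (e : D.I × D.I) (k : D.K) (s : ℕ) :
    ∑ p ∈ D.Pset, D.lam k s * (if p = 1 then ∑ p' ∈ D.Pset, r e k s p' else 0) =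
      ∑ p ∈ D.Pset, D.lam k s * r e k s p := by
  rw [← Finset.mul_sum, ← Finset.mul_sum, Finset.sum_ite_eq', if_pos D.one_mem_Pset]

end NSData

/-- From any feasible solution of (NLP), concentrating all the flow on the first
path (and setting `z_{ij}^{k,s,p} := Σ_{p'} r̄_{ij}^{k,s,p'}`) yields another feasible solution
of (NLP) with the same objective value; moreover `Σ_{p} r̄_{ij}^{k,s,p} ≤ 1` always holds. -/
theorem statement6 (D : NSData)
    (xs : D.I → D.K → ℕ → ℝ) (xk : D.I → D.K → ℝ) (y : D.I → ℝ)
    (z : D.I × D.I → D.K → ℕ → ℕ → ℝ) (zk : D.I × D.I → D.K → ℝ)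
    (r : D.I × D.I → D.K → ℕ → ℕ → ℝ) (rp : D.K → ℕ → ℕ → ℝ) (th : D.K → ℕ → ℝ)
    (hfeas : D.NLPFeas xs xk y z zk r rp th) :
    (∀ e ∈ D.L, ∀ k : D.K, ∀ s ∈ D.Fk0 k, ∑ p ∈ D.Pset, r e k s p ≤ 1) ∧
    D.NLPFeas xs xk y
      (fun e k s _ => ∑ p' ∈ D.Pset, r e k s p')
      zk
      (fun e k s p => if p = 1 then ∑ p' ∈ D.Pset, r e k s p' else 0)
      (fun _ _ p => if p = 1 then (1 : ℝ) else 0)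
      th ∧
    D.Obj y (fun e k s p => if p = 1 then ∑ p' ∈ D.Pset, r e k s p' else 0) = D.Obj y r := by
  obtain ⟨h1, h2, h3, h4, h5, h6, h7, h8, h9, h10, h12, h16, ⟨hxs, hxk, hy, hz, hzk⟩,
    hr, hrp, hth⟩ := hfeas
  have hagg : ∀ e ∈ D.L, ∀ k : D.K, ∀ s ∈ D.Fk0 k,
      ∑ p ∈ D.Pset, r e k s p = ∑ p ∈ D.Pset, rp k s p * z e k s p :=
    fun e he k s hs => Finset.sum_congr rfl fun p hp => h7 e he k s hs p hp
  have hle : ∀ e ∈ D.L, ∀ k : D.K, ∀ s ∈ D.Fk0 k, ∑ p ∈ D.Pset, r e k s p ≤ 1 := by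
    intro e he k s hs
    rw [hagg e he k s hs]
    exact weighted_sum_le (hrp k s hs) (h6 k s hs) fun p hp => (hz e he k s hs p hp).2
  have hnonneg : ∀ e ∈ D.L, ∀ k : D.K, ∀ s ∈ D.Fk0 k, 0 ≤ ∑ p ∈ D.Pset, r e k s p :=
    fun e he k s hs => Finset.sum_nonneg (hr e he k s hs)
  refine ⟨hle, ⟨h1, h2, h3, h4, ?_, ?_, ?_, ?_, ?_, h10, h12, ?_,
    ⟨hxs, hxk, hy, fun e he k s hs _ _ => ⟨hnonneg e he k s hs, hle e he k s hs⟩, hzk⟩,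
    ?_, ?_, hth⟩, ?_⟩
  · intro k s hs _ _ i
    have hin := h7.sum_mul_sum (Finset.filter_subset (fun e => e.2 = i) D.L) (fun _ => 1) k hs
    have hout := h7.sum_mul_sum (Finset.filter_subset (fun e => e.1 = i) D.L) (fun _ => 1) k hs
    simp only [one_mul] at hin hout
    simp only [NSData.inS, NSData.outS]
    rw [hin, hout, ← Finset.sum_sub_distrib]
    calc _ = ∑ p ∈ D.Pset, rp k s p * D.bfun xs i k s :=
          Finset.sum_congr rfl fun p hp => by
            rw [← mul_sub, ← h5 k s hs p hp i, NSData.inS, NSData.outS]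
      _ = _ := by rw [← Finset.sum_mul, h6 k s hs, one_mul]
  · intro k s _
    rw [Finset.sum_ite_eq', if_pos D.one_mem_Pset]
  · intro e _ k s _ p _
    simp only [ite_mul, one_mul, zero_mul]
  · intro e he
    simp only [D.sum_lam_mul_concentrate]
    exact h8 e he
  · intro e he k s hs _ _
    simp only [hagg e he k s hs]
    exact weighted_sum_le (hrp k s hs) (h6 k s hs) (h9 e he k s hs)
  · intro k s hs _ _
    simp only [h7.sum_mul_sum subset_rfl D.dl k hs]
    exact weighted_sum_le (hrp k s hs) (h6 k s hs) (h16 k s hs)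
  · intro e he k s hs p _
    dsimp only
    split_ifs
    exacts [hnonneg e he k s hs, le_rfl]
  · intro k s _ p _
    dsimp only
    split_ifs
    exacts [zero_le_one, le_rfl]
  · simp only [NSData.Obj, D.sum_lam_mul_concentrate]
end

section
/- Every feasible solution (x, y, r, z, θ) together with (r^{k,s,p}) of (MINLP) satisfies the two families of valid inequalities: (C18) Σ_{p∈P} r_{ij}^{k,s,p} ≤ z_{ij}^k for all (i,j) ∈ L, k ∈ K, s ∈ F^k∪{0}; and (C19) θ^{k,s} ≥ Σ_{(i,j)∈L} d_{ij} Σ_{p∈P} r_{ij}^{k,s,p} for all k ∈ K, s ∈ F^k∪{0}. -/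
open Finset

/-- every feasible solution of (MINLP) satisfies the two families of valid
inequalities (C18) and (C19). -/
theorem statement14 (D : NSData)
    (xs : D.I → D.K → ℕ → ℝ) (xk : D.I → D.K → ℝ) (y : D.I → ℝ)
    (z : D.I × D.I → D.K → ℕ → ℕ → ℝ) (zk : D.I × D.I → D.K → ℝ)
    (r : D.I × D.I → D.K → ℕ → ℕ → ℝ) (rp : D.K → ℕ → ℕ → ℝ) (th : D.K → ℕ → ℝ)
    (hfeas : D.MINLPFeas xs xk y z zk r rp th) :
    D.C18 zk r ∧ D.C19 r th := by
  obtain ⟨-, -, -, -, -, h6, h7, -, h9, -, h11, -, -, -, hrp, -⟩ := hfeas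
  constructor
  · intro e he k s hs
    calc ∑ p ∈ D.Pset, r e k s p
        ≤ ∑ p ∈ D.Pset, rp k s p * zk e k := by
          refine Finset.sum_le_sum fun p hp => ?_
          rw [h7 e he k s hs p hp]
          exact mul_le_mul_of_nonneg_left (h9 e he k s hs p hp) (hrp k s hs p hp)
      _ = zk e k := by rw [← Finset.sum_mul, h6 k s hs, one_mul]
  · intro k s hs
    calc ∑ e ∈ D.L, D.dl e * ∑ p ∈ D.Pset, r e k s p
        = ∑ e ∈ D.L, ∑ p ∈ D.Pset, rp k s p * (D.dl e * z e k s p) := by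
          refine Finset.sum_congr rfl fun e he => ?_
          rw [Finset.mul_sum]
          refine Finset.sum_congr rfl fun p hp => ?_
          rw [h7 e he k s hs p hp]
          ring
      _ = ∑ p ∈ D.Pset, rp k s p * ∑ e ∈ D.L, D.dl e * z e k s p := by
          rw [Finset.sum_comm]
          simp only [Finset.mul_sum]
      _ ≤ ∑ p ∈ D.Pset, rp k s p * th k s := by
          refine Finset.sum_le_sum fun p hp => ?_
          exact mul_le_mul_of_nonneg_left
            ((h11 k s hs).2 (Set.mem_image_of_mem _ (Finset.mem_coe.mpr hp))) (hrp k s hs p hp)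
      _ = th k s := by rw [← Finset.sum_mul, h6 k s hs, one_mul]
end
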